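/- arXiv:1311.0697 — 2 statements merged into one kernel-verified Lean document; each statement's English description precedes it below -/
import Mathlib

section
/- Let (Γ, 𝔊, η) be a minimal non-Kneser triple with Δ := ker η. Then: (1) Fix_Γ(𝔊) ∩ η⁻¹(C(𝔊)) = {1}, where C(𝔊) is the center of 𝔊; (2) if 𝔊 is abelian then Fix_Γ(𝔊) = {1}, i.e. Γ acts faithfully on 𝔊; (3) if 𝔊 is nilpotent then 𝔊 is a p-group for some prime p; and if moreover p does not divide the index (Γ : Δ), then 𝔊 is an elementary abelian p-group whose only Γ-invariant subgroups are {1} and 𝔊 (a simple 𝔽_p[Γ]-module), Γ acts faithfully on 𝔊, and η is a coboundary, i.e. (writing 𝔊 additively) η(γ) = γ•g − g for some g ∈ 𝔊. -/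
/-- A subgroup whose left cosets are the fibres of `f` has as index the number of values of `f`. -/
theorem index_eq_card_range_of_fibers {Γ X : Type*} [Group Γ] (f : Γ → X) (D : Subgroup Γ)
    (h : ∀ σ τ : Γ, σ⁻¹ * τ ∈ D ↔ f σ = f τ) : D.index = Nat.card (Set.range f) := by
  refine Nat.card_congr (Equiv.ofBijective
    (fun q : Γ ⧸ D => Quotient.liftOn' q (fun σ => (⟨f σ, σ, rfl⟩ : Set.range f)) ?_) ⟨?_, ?_⟩)
  · intro σ τ hst
    exact Subtype.ext ((h σ τ).1 (QuotientGroup.leftRel_apply.1 hst))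
  · intro q r
    induction q using Quotient.inductionOn'
    induction r using Quotient.inductionOn'
    intro hqr
    exact Quotient.sound' (QuotientGroup.leftRel_apply.2 ((h _ _).2 (congrArg Subtype.val hqr)))
  · rintro ⟨_, σ, rfl⟩
    exact ⟨Quotient.mk'' σ, rfl⟩

theorem smul_mem_of_characteristic {Γ G : Type*} [Group Γ] [Group G] [MulDistribMulAction Γ G]
    (H : Subgroup G) [hH : H.Characteristic] (γ : Γ) (g : G) (hg : g ∈ H) : γ • g ∈ H :=
  Subgroup.characteristic_iff_le_comap.1 hH (MulDistribMulAction.toMulEquiv G γ) hg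

section Cocycle

variable {Γ G : Type*} [Group Γ] [Group G] [MulDistribMulAction Γ G] {η : Γ → G}

theorem cocycle_one (hcoc : ∀ σ τ : Γ, η (σ * τ) = η σ * σ • η τ) : η 1 = 1 := by
  simpa using hcoc 1 1

theorem smul_cocycle_inv (hcoc : ∀ σ τ : Γ, η (σ * τ) = η σ * σ • η τ) (σ : Γ) :
    σ • η σ⁻¹ = (η σ)⁻¹ := by
  have h := hcoc σ σ⁻¹
  rw [mul_inv_cancel, cocycle_one hcoc] at h
  exact eq_inv_of_mul_eq_one_right h.symm

theorem cocycle_inv_mul (hcoc : ∀ σ τ : Γ, η (σ * τ) = η σ * σ • η τ) (σ τ : Γ) :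
    η (σ⁻¹ * τ) = σ⁻¹ • ((η σ)⁻¹ * η τ) := by
  rw [hcoc, smul_mul', ← smul_cocycle_inv hcoc, inv_smul_smul]

/-- The preimage of an invariant subgroup under a 1-cocycle. -/
def cocyclePreimage (hcoc : ∀ σ τ : Γ, η (σ * τ) = η σ * σ • η τ) (a : Subgroup G)
    (ha : ∀ (γ : Γ) (g : G), g ∈ a → γ • g ∈ a) : Subgroup Γ where
  carrier := {σ | η σ ∈ a}
  one_mem' := by
    rw [Set.mem_ofPred_eq, cocycle_one hcoc]
    exact a.one_mem
  mul_mem' := by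
    intro σ τ hσ hτ
    rw [Set.mem_ofPred_eq, hcoc]
    exact a.mul_mem hσ (ha _ _ hτ)
  inv_mem' := by
    intro σ hσ
    have h := cocycle_inv_mul hcoc σ 1
    rw [mul_one, cocycle_one hcoc, mul_one] at h
    rw [Set.mem_ofPred_eq, h]
    exact ha _ _ (a.inv_mem hσ)

theorem inv_mul_mem_cocyclePreimage (hcoc : ∀ σ τ : Γ, η (σ * τ) = η σ * σ • η τ)
    (a : Subgroup G) (ha : ∀ (γ : Γ) (g : G), g ∈ a → γ • g ∈ a) (σ τ : Γ) :
    σ⁻¹ * τ ∈ cocyclePreimage hcoc a ha ↔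
      (QuotientGroup.mk (η σ) : G ⧸ a) = QuotientGroup.mk (η τ) := by
  rw [QuotientGroup.eq]
  change η (σ⁻¹ * τ) ∈ a ↔ _
  rw [cocycle_inv_mul hcoc]
  refine ⟨fun h => ?_, ha _ _⟩
  simpa using ha σ _ h

theorem index_eq_card_range_cocycle (hcoc : ∀ σ τ : Γ, η (σ * τ) = η σ * σ • η τ)
    (D : Subgroup Γ) (hD : (D : Set Γ) = η ⁻¹' {1}) : D.index = Nat.card (Set.range η) := by
  refine index_eq_card_range_of_fibers η D fun σ τ => ?_
  rw [← SetLike.mem_coe, hD, Set.mem_preimage, Set.mem_singleton_iff, cocycle_inv_mul hcoc,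
    inv_smul_eq_iff, smul_one, inv_mul_eq_one]

/-- If the cocycle induced modulo an ideal `a` is surjective, the index of `a` divides the index
of the kernel. -/
theorem index_dvd_index_ker (hcoc : ∀ σ τ : Γ, η (σ * τ) = η σ * σ • η τ)
    (D : Subgroup Γ) (hD : (D : Set Γ) = η ⁻¹' {1})
    (a : Subgroup G) (ha : ∀ (γ : Γ) (g : G), g ∈ a → γ • g ∈ a)
    (hs : Function.Surjective (fun γ : Γ => (QuotientGroup.mk (η γ) : G ⧸ a))) :
    a.index ∣ D.index := by
  have h := index_eq_card_range_of_fibers _ _ (inv_mul_mem_cocyclePreimage hcoc a ha)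
  rw [hs.range_eq, Nat.card_univ] at h
  change _ = a.index at h
  rw [← h]
  refine Subgroup.index_dvd_of_le fun σ hσ => ?_
  rw [← SetLike.mem_coe, hD] at hσ
  change η σ ∈ a
  rw [show η σ = 1 from hσ]
  exact a.one_mem

/-- The values of a cocycle at elements that act trivially, as far as they are central. -/
def centralFixValues (hcoc : ∀ σ τ : Γ, η (σ * τ) = η σ * σ • η τ) : Subgroup G where
  carrier := {g | g ∈ Subgroup.center G ∧ ∃ x : Γ, (∀ g : G, x • g = g) ∧ η x = g}
  one_mem' := ⟨Subgroup.one_mem _, 1, one_smul Γ, cocycle_one hcoc⟩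
  mul_mem' := by
    rintro _ _ ⟨ha, x, hx, rfl⟩ ⟨hb, y, hy, rfl⟩
    exact ⟨Subgroup.mul_mem _ ha hb, x * y, fun g => by rw [mul_smul, hy, hx],
      by rw [hcoc, hx]⟩
  inv_mem' := by
    rintro _ ⟨ha, x, hx, rfl⟩
    have hx' : ∀ g : G, x⁻¹ • g = g := fun g => by rw [inv_smul_eq_iff, hx]
    refine ⟨Subgroup.inv_mem _ ha, x⁻¹, hx', ?_⟩
    rw [← smul_cocycle_inv hcoc, hx]

theorem centralFixValues_normal (hcoc : ∀ σ τ : Γ, η (σ * τ) = η σ * σ • η τ) :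
    (centralFixValues hcoc).Normal := by
  refine ⟨fun n hn g => ?_⟩
  rwa [Subgroup.mem_center_iff.1 hn.1 g, mul_inv_cancel_right]

theorem smul_mem_centralFixValues (hcoc : ∀ σ τ : Γ, η (σ * τ) = η σ * σ • η τ) (γ : Γ) (g : G)
    (hg : g ∈ centralFixValues hcoc) : γ • g ∈ centralFixValues hcoc := by
  obtain ⟨hc, x, hx, rfl⟩ := hg
  have hc' := smul_mem_of_characteristic (Subgroup.center G) γ _ hc
  refine ⟨hc', γ * x * γ⁻¹, fun g => by rw [mul_smul, mul_smul, hx, smul_inv_smul], ?_⟩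
  rw [hcoc, hcoc, mul_smul, hx, smul_cocycle_inv hcoc, Subgroup.mem_center_iff.1 hc',
    mul_inv_cancel_right]

theorem surjective_of_surjective_mod_centralFixValues
    (hcoc : ∀ σ τ : Γ, η (σ * τ) = η σ * σ • η τ)
    (hs : Function.Surjective
      (fun γ : Γ => (QuotientGroup.mk (η γ) : G ⧸ centralFixValues hcoc))) :
    Function.Surjective η := by
  intro g
  obtain ⟨γ, hγ⟩ := hs (QuotientGroup.mk g)
  obtain ⟨-, x, -, hx⟩ := smul_mem_centralFixValues hcoc γ⁻¹ _ (QuotientGroup.eq.1 hγ)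
  exact ⟨γ * x, by rw [hcoc, hx, smul_inv_smul, mul_inv_cancel_left]⟩

end Cocycle

/-- A cocycle with values in an abelian group of exponent dividing `p` is a coboundary if the
index of its kernel is finite and coprime to `p`. -/
theorem exists_coboundary_of_coprime_index {Γ A : Type*} [Group Γ] [CommGroup A]
    [MulDistribMulAction Γ A] {η : Γ → A} (hcoc : ∀ σ τ : Γ, η (σ * τ) = η σ * σ • η τ)
    (D : Subgroup Γ) [D.FiniteIndex] (hD : (D : Set Γ) = η ⁻¹' {1}) {p : ℕ}
    (hp : ∀ g : A, g ^ p = 1) (hcop : Nat.Coprime D.index p) :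
    ∃ g : A, ∀ γ : Γ, η γ = (γ • g) * g⁻¹ := by
  classical
  let f : Γ ⧸ D → A := fun q => Quotient.liftOn' q η fun σ τ h => by
    have h' : σ⁻¹ * τ ∈ (D : Set Γ) := QuotientGroup.leftRel_apply.1 h
    rw [hD, Set.mem_preimage, Set.mem_singleton_iff, cocycle_inv_mul hcoc, inv_smul_eq_iff,
      smul_one, inv_mul_eq_one] at h'
    exact h'
  let : Fintype (Γ ⧸ D) := D.fintypeQuotientOfFiniteIndex
  have key : ∀ σ : Γ, ∏ q, f q = η σ ^ D.index * σ • ∏ q, f q := by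
    intro σ
    calc ∏ q, f q = ∏ q, f (σ • q) := (Equiv.prod_comp (MulAction.toPerm σ) f).symm
      _ = ∏ q, (η σ * σ • f q) := by
        refine Finset.prod_congr rfl fun q _ => ?_
        induction q using Quotient.inductionOn'
        exact hcoc _ _
      _ = η σ ^ D.index * σ • ∏ q, f q := by
        rw [Finset.prod_mul_distrib, Finset.prod_const, Finset.smul_prod', Finset.card_univ,
          Subgroup.index_eq_card, Nat.card_eq_fintype_card]
  have hpow : ∀ x : A, (x ^ (D.index : ℤ)) ^ (D.index.gcdA p) = x := by
    intro x
    have hb := Nat.gcd_eq_gcd_ab D.index p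
    rw [hcop] at hb
    calc (x ^ (D.index : ℤ)) ^ (D.index.gcdA p)
        = (x ^ (D.index : ℤ)) ^ (D.index.gcdA p) * (x ^ (p : ℤ)) ^ (D.index.gcdB p) := by
          rw [zpow_natCast x p, hp, one_zpow, mul_one]
      _ = x := by
          rw [← zpow_mul, ← zpow_mul, ← zpow_add, ← hb, Nat.cast_one, zpow_one]
  refine ⟨((∏ q, f q)⁻¹) ^ (D.index.gcdA p), fun σ => ?_⟩
  rw [smul_zpow', ← inv_zpow, ← mul_zpow, inv_inv, smul_inv']
  conv_lhs => rw [← hpow (η σ)]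
  rw [zpow_natCast]
  congr 1
  rw [eq_inv_mul_iff_mul_eq, mul_comm]
  exact (key σ).symm


/-- Let `(Γ, 𝔊, η)` be a minimal non-Kneser triple (Γ, 𝔊 finite, `η` a generating 1-cocycle
that is not surjective, whose induced cocycle modulo every nontrivial ideal is surjective,
and which is normalized).  Then:
(1) `Fix_Γ(𝔊) ∩ η⁻¹(C(𝔊)) = {1}`;
(2) if `𝔊` is abelian then `Γ` acts faithfully on `𝔊`;
(3) if `𝔊` is nilpotent then `𝔊` is a `p`-group for some prime `p`; if moreover `p` does not
divide `(Γ : Δ)` (where `Δ = ker η`), then `𝔊` is an elementary abelian `p`-group whose only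
`Γ`-invariant subgroups are `{1}` and `𝔊`, `Γ` acts faithfully, and `η` is a coboundary. -/
theorem minimal_nonKneser_structure
    {Γ 𝔊 : Type*} [Group Γ] [Finite Γ] [Group 𝔊] [Finite 𝔊]
    [MulDistribMulAction Γ 𝔊] (η : Γ → 𝔊)
    (hcoc : ∀ σ τ : Γ, η (σ * τ) = η σ * σ • η τ)
    (hgen : Subgroup.closure (Set.range η) = ⊤)
    (hns : ¬ Function.Surjective η)
    (hmin : ∀ a : Subgroup 𝔊, a.Normal → (∀ (γ : Γ) (g : 𝔊), g ∈ a → γ • g ∈ a) → a ≠ ⊥ →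
        Function.Surjective (fun γ : Γ => (QuotientGroup.mk (η γ) : 𝔊 ⧸ a)))
    (hnorm : ∀ x : Γ, (∀ g : 𝔊, x • g = g) → η x = 1 → x = 1) :
    -- (1)
    (∀ x : Γ, (∀ g : 𝔊, x • g = g) → η x ∈ Subgroup.center 𝔊 → x = 1) ∧
    -- (2)
    ((∀ a b : 𝔊, a * b = b * a) → ∀ x : Γ, (∀ g : 𝔊, x • g = g) → x = 1) ∧
    -- (3)
    (Group.IsNilpotent 𝔊 → ∃ p : ℕ, p.Prime ∧ IsPGroup p 𝔊 ∧
      ∀ D : Subgroup Γ, (D : Set Γ) = η ⁻¹' {1} → ¬ (p ∣ D.index) →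
        ((∀ g : 𝔊, g ^ p = 1) ∧ (∀ a b : 𝔊, a * b = b * a) ∧
         (∀ a : Subgroup 𝔊, (∀ (γ : Γ) (g : 𝔊), g ∈ a → γ • g ∈ a) → a = ⊥ ∨ a = ⊤) ∧
         (∀ x : Γ, (∀ g : 𝔊, x • g = g) → x = 1) ∧
         (∃ g : 𝔊, ∀ γ : Γ, η γ = (γ • g) * g⁻¹))) := by
  have faithful_center :
      ∀ x : Γ, (∀ g : 𝔊, x • g = g) → η x ∈ Subgroup.center 𝔊 → x = 1 := by
    intro x hx hc
    refine hnorm x hx ?_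
    by_contra hne
    refine hns (surjective_of_surjective_mod_centralFixValues hcoc
      (hmin _ (centralFixValues_normal hcoc) (smul_mem_centralFixValues hcoc) fun hbot => hne ?_))
    have hmem : η x ∈ centralFixValues hcoc := ⟨hc, x, hx, rfl⟩
    rwa [hbot, Subgroup.mem_bot] at hmem
  have faithful : (∀ a b : 𝔊, a * b = b * a) → ∀ x : Γ, (∀ g : 𝔊, x • g = g) → x = 1 :=
    fun hab x hx => faithful_center x hx (Subgroup.mem_center_iff.2 fun g => hab g _)
  refine ⟨faithful_center, faithful, fun hnil => ?_⟩
  have hnontriv : Nontrivial 𝔊 := by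
    by_contra h
    rw [not_nontrivial_iff_subsingleton] at h
    exact hns fun g => ⟨1, Subsingleton.elim _ _⟩
  have sylow_index_dvd : ∀ (D : Subgroup Γ), (D : Set Γ) = η ⁻¹' {1} →
      ∀ (q : ℕ) [Fact q.Prime], q ∣ Nat.card 𝔊 → ∀ P : Sylow q 𝔊, P.index ∣ D.index := by
    intro D hD q _ hq P
    have hPn : (P : Subgroup 𝔊).Normal := by
      have h := (Group.isNilpotent_of_finite_tfae (G := 𝔊)).out 0 3
      exact h.1 hnil q inferInstance P
    have hPc := P.characteristic_of_normal hPn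
    have hinv := smul_mem_of_characteristic (Γ := Γ) (P : Subgroup 𝔊)
    exact index_dvd_index_ker hcoc D hD _ hinv
      (hmin _ hPn hinv (P.ne_bot_of_dvd_card hq))
  have hker : ((cocyclePreimage hcoc ⊥ fun γ g hg => by
      rw [Subgroup.mem_bot] at hg ⊢; rw [hg, smul_one] : Subgroup Γ) : Set Γ) = η ⁻¹' {1} := by
    ext σ
    exact Subgroup.mem_bot
  have hcard1 : Nat.card 𝔊 ≠ 1 := Finite.one_lt_card.ne'
  obtain ⟨p, hp, hpd⟩ := Nat.exists_prime_and_dvd hcard1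
  have : Fact p.Prime := ⟨hp⟩
  have hpgroup : IsPGroup p 𝔊 := by
    refine IsPGroup.of_card (n := (Nat.card 𝔊).primeFactorsList.length)
      (Nat.eq_prime_pow_of_unique_prime_dvd Nat.card_pos.ne' fun {q} hq hqd => ?_)
    by_contra hqp
    have : Fact q.Prime := ⟨hq⟩
    have P : Sylow p 𝔊 := default
    have Q : Sylow q 𝔊 := default
    have hP := sylow_index_dvd _ hker p hpd P
    have hQ := sylow_index_dvd _ hker q hqd Q
    have hcop : Nat.Coprime (Nat.card P) (Nat.card Q) :=
      IsPGroup.coprime_card_of_ne p q (Ne.symm hqp) _ _ P.isPGroup' Q.isPGroup'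
    have hdvd : Nat.card 𝔊 ∣ Nat.card (Set.range η) := by
      rw [← index_eq_card_range_cocycle hcoc _ hker]
      have hPQ : Nat.card P ∣ Q.index := by
        refine hcop.dvd_of_dvd_mul_left ?_
        rw [Subgroup.card_mul_index]
        exact Subgroup.card_subgroup_dvd_card _
      rw [← (P : Subgroup 𝔊).card_mul_index]
      exact (P.card_coprime_index).mul_dvd_of_dvd_of_dvd (hPQ.trans hQ) hP
    have hrange : Set.range η = Set.univ := by
      refine Set.eq_of_subset_of_ncard_le (Set.subset_univ _) ?_ (Set.toFinite _)
      rw [Set.ncard_univ]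
      have : Nonempty (Set.range η) := ⟨⟨η 1, 1, rfl⟩⟩
      exact Nat.le_of_dvd Nat.card_pos hdvd
    exact hns (Set.range_eq_univ.1 hrange)
  refine ⟨p, hp, hpgroup, fun D hD hpD => ?_⟩
  have ideal_eq_top : ∀ a : Subgroup 𝔊, a.Normal → (∀ (γ : Γ) (g : 𝔊), g ∈ a → γ • g ∈ a) →
      a ≠ ⊥ → a = ⊤ := by
    intro a han hinv hne
    have hdvd := index_dvd_index_ker hcoc D hD a hinv (hmin a han hinv hne)
    obtain ⟨n, hn⟩ := hpgroup.index a
    rcases n with _ | n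
    · exact Subgroup.index_eq_one.1 (by simpa using hn)
    · exact absurd ((hn ▸ dvd_pow_self p n.succ_ne_zero).trans hdvd) hpD
  have hcenter : Subgroup.center 𝔊 = ⊤ :=
    ideal_eq_top _ inferInstance (smul_mem_of_characteristic _)
      ((Subgroup.nontrivial_iff_ne_bot _).1 hpgroup.center_nontrivial)
  have hab : ∀ a b : 𝔊, a * b = b * a := fun a b =>
    Subgroup.mem_center_iff.1 (hcenter ▸ Subgroup.mem_top b) a
  let : CommGroup 𝔊 := { ‹Group 𝔊› with mul_comm := hab }
  have hexp : ∀ g : 𝔊, g ^ p = 1 := by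
    have htop : (powMonoidHom p : 𝔊 →* 𝔊).ker = ⊤ := by
      refine ideal_eq_top _ inferInstance (fun γ g hg => ?_) fun hbot => ?_
      · rw [MonoidHom.mem_ker, powMonoidHom_apply] at hg ⊢
        rw [← smul_pow', hg, smul_one]
      · obtain ⟨g, hg⟩ := exists_prime_orderOf_dvd_card' p hpd
        have hmem : g ∈ (powMonoidHom p : 𝔊 →* 𝔊).ker := by
          rw [MonoidHom.mem_ker, powMonoidHom_apply, ← hg, pow_orderOf_eq_one]
        rw [hbot, Subgroup.mem_bot] at hmem
        rw [hmem, orderOf_one] at hg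
        exact hp.one_lt.ne hg
    intro g
    have hmem : g ∈ (powMonoidHom p : 𝔊 →* 𝔊).ker := htop ▸ Subgroup.mem_top g
    exact hmem
  refine ⟨hexp, hab, fun a ha => ?_, faithful hab, ?_⟩
  · exact or_iff_not_imp_left.2 (ideal_eq_top a inferInstance ha)
  · exact exists_coboundary_of_coprime_index hcoc D hD hexp
      ((Nat.Prime.coprime_iff_not_dvd hp).2 hpD).symm
end

section
/- Let (Γ, 𝔊, η) be a minimal non-Kneser triple in which 𝔊 is abelian of exponent k and the action of Γ is given by a character χ : Γ → (ℤ/kℤ)^×, i.e. γ•g = g^{χ(γ)} for all γ, g. Then either k = p is an odd prime or k = 4, and 𝔊 is cyclic of order k. If k = p is an odd prime, then |Γ| = r with 2 ≤ r dividing p − 1, and there exist a group isomorphism φ from Γ onto the unique subgroup U of order r of 𝔽_p^× and a group isomorphism ψ : 𝔊 → 𝔽_p^+ such that ψ(γ•g) = φ(γ)·ψ(g) and ψ(η(γ)) = φ(γ) − 1 for all γ ∈ Γ, g ∈ 𝔊. If k = 4, then Γ is cyclic of order 2 acting on 𝔊 ≅ ℤ/4ℤ by inversion, and there exist isomorphisms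 φ : Γ → ℤ/2ℤ and ψ : 𝔊 → ℤ/4ℤ with ψ(γ•g) = (−1)^{φ(γ)}·ψ(g) for all γ, g, and ψ(η(γ)) a generator of ℤ/4ℤ for the nontrivial element γ of Γ. -/
namespace NonKneser

section ZMod

variable {Γ : Type*} [Group Γ] {k : ℕ}

/-- A residue modulo `k` whose reduction modulo `p ∣ k` vanishes is divisible by `p`. -/
lemma dvd_of_castHom_eq_zero [NeZero k] {p : ℕ} (hp : p ∣ k) {z : ZMod k}
    (hz : ZMod.castHom hp (ZMod p) z = 0) : (p : ZMod k) ∣ z := by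
  rw [← ZMod.natCast_zmod_val z, map_natCast, ZMod.natCast_eq_zero_iff] at hz
  rw [← ZMod.natCast_zmod_val z]
  exact Nat.cast_dvd_cast hz

/-- A residue is determined by its reduction modulo `p` and the quotient of its
representative by `p`. -/
lemma eq_of_castHom_eq_of_val_div_eq [NeZero k] {p : ℕ} (hp : p ∣ k) {x y : ZMod k}
    (h : ZMod.castHom hp (ZMod p) x = ZMod.castHom hp (ZMod p) y)
    (hdiv : x.val / p = y.val / p) : x = y := by
  rw [← ZMod.natCast_zmod_val x, ← ZMod.natCast_zmod_val y, map_natCast, map_natCast,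
    ZMod.natCast_eq_natCast_iff'] at h
  apply ZMod.val_injective k
  rw [← Nat.div_add_mod x.val p, ← Nat.div_add_mod y.val p, h, hdiv]

lemma val_div_lt [NeZero k] {p : ℕ} (hp : p ∣ k) (x : ZMod k) : x.val / p < k / p :=
  Nat.div_lt_div_of_lt_of_dvd hp x.val_lt

/-- A group embedded in `(ℤ/kℤ)ˣ` has order at most `(p - 1) * (k / p)` for prime `p ∣ k`. -/
lemma card_le_of_injective [Finite Γ] [NeZero k] {χ : Γ →* (ZMod k)ˣ}
    (hχ : Function.Injective χ) {p : ℕ} (hp : p.Prime) (hpk : p ∣ k) :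
    Nat.card Γ ≤ (p - 1) * (k / p) := by
  have : Fact p.Prime := ⟨hp⟩
  let F : Γ → (ZMod p)ˣ × Fin (k / p) := fun γ =>
    (Units.map (ZMod.castHom hpk (ZMod p)).toMonoidHom (χ γ),
      ⟨(χ γ : ZMod k).val / p, val_div_lt hpk _⟩)
  have hF : Function.Injective F := by
    intro a b hab
    obtain ⟨h1, h2⟩ := Prod.mk.inj hab
    exact hχ (Units.ext (eq_of_castHom_eq_of_val_div_eq hpk
      (congrArg Units.val h1) (Fin.mk.inj h2)))
  calc Nat.card Γ ≤ Nat.card ((ZMod p)ˣ × Fin (k / p)) := Nat.card_le_card_of_injective F hF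
    _ = (p - 1) * (k / p) := by
      rw [Nat.card_prod, Nat.card_eq_fintype_card, ZMod.card_units, Nat.card_fin]

variable {χ : Γ →* (ZMod k)ˣ} {f : Γ → ZMod k}

lemma cocycle_one (hf : ∀ σ τ, f (σ * τ) = f σ + χ σ * f τ) : f 1 = 0 := by
  simpa using hf 1 1

/-- The symmetry relation for a cocycle of a commuting pair. -/
lemma cocycle_symm (hχ : Function.Injective χ)
    (hf : ∀ σ τ, f (σ * τ) = f σ + χ σ * f τ) (σ τ : Γ) :
    ((χ σ : ZMod k) - 1) * f τ = ((χ τ : ZMod k) - 1) * f σ := by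
  have hc : σ * τ = τ * σ := hχ (by rw [map_mul, map_mul, mul_comm])
  have h := hf σ τ
  rw [hc, hf τ σ] at h
  linear_combination -h

/-- If a cocycle is surjective modulo a prime `q`, then the character is trivial modulo `q`. -/
lemma castHom_character_eq_one (hχ : Function.Injective χ)
    (hf : ∀ σ τ, f (σ * τ) = f σ + χ σ * f τ) {q : ℕ} (hq : q.Prime) (hqk : q ∣ k)
    (hs : Function.Surjective fun γ => ZMod.castHom hqk (ZMod q) (f γ)) (γ : Γ) :
    ZMod.castHom hqk (ZMod q) (χ γ) = 1 := by
  have : Fact q.Prime := ⟨hq⟩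
  by_contra hne
  set c := ZMod.castHom hqk (ZMod q)
  have hne' : c (χ γ) - 1 ≠ 0 := sub_ne_zero.2 hne
  have hsymm : ∀ τ, (c (χ γ) - 1) * c (f τ) = (c (χ τ) - 1) * c (f γ) := fun τ => by
    simpa using congrArg c (cocycle_symm hχ hf γ τ)
  obtain ⟨τ, hτ⟩ := hs (-(c (f γ)) / (c (χ γ) - 1))
  have h1 := hsymm τ
  change c (f τ) = _ at hτ
  rw [hτ, mul_div_cancel₀ _ hne'] at h1
  have hu : IsUnit (c (χ τ)) := (χ τ).isUnit.map c
  have h0 : c (f γ) = 0 := by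
    have : c (χ τ) * c (f γ) = 0 := by linear_combination -h1
    exact (mul_eq_zero.1 this).resolve_left hu.ne_zero
  obtain ⟨ρ, hρ⟩ := hs 1
  have h2 := hsymm ρ
  change c (f ρ) = 1 at hρ
  rw [hρ, h0] at h2
  exact hne' (by simpa using h2)

/-- The values of a cocycle on powers of an element acting by `1 + x` with `x ^ 2 = 0`. -/
lemma cocycle_pow (hf : ∀ σ τ, f (σ * τ) = f σ + χ σ * f τ) {τ : Γ} {x : ZMod k}
    (hτ : (χ τ : ZMod k) = 1 + x) (hx : x * x = 0) (i : ℕ) :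
    (χ (τ ^ i) : ZMod k) = 1 + i * x ∧ f (τ ^ i) = (i + i.choose 2 * x) * f τ := by
  induction i with
  | zero => simp [cocycle_one hf]
  | succ i ih =>
    obtain ⟨h1, h2⟩ := ih
    constructor
    · rw [pow_succ, map_mul, Units.val_mul, h1, hτ]
      push_cast
      linear_combination (i : ZMod k) * hx
    · rw [pow_succ, hf, h1, h2, Nat.choose_succ_succ' i 1, Nat.choose_one_right]
      push_cast
      ring

/-- A cocycle for an injective character modulo a composite `k` that is surjective modulo every
proper divisor of `k` forces `k = 4`. -/
lemma eq_four_of_not_prime [Finite Γ] [NeZero k] (hk1 : k ≠ 1) (hkp : ¬ k.Prime)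
    (hχ : Function.Injective χ) (hf : ∀ σ τ, f (σ * τ) = f σ + χ σ * f τ)
    (hs : ∀ (d : ℕ) (h : d ∣ k), d ≠ k →
      Function.Surjective fun γ => ZMod.castHom h (ZMod d) (f γ)) : k = 4 := by
  have hk0 : k ≠ 0 := NeZero.ne k
  have hne : ∀ q : ℕ, q.Prime → q ≠ k := fun q hq h => hkp (h ▸ hq)
  have hone : ∀ (q : ℕ) (_ : q.Prime) (h : q ∣ k) (γ : Γ),
      ZMod.castHom h (ZMod q) (χ γ) = 1 := fun q hq h γ =>
    castHom_character_eq_one hχ hf hq h (hs q h (hne q hq)) γ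
  let D : ∀ q : ℕ, q ∣ k → Γ → Fin (k / q) := fun q hqk γ =>
    ⟨(χ γ : ZMod k).val / q, val_div_lt hqk _⟩
  have hD : ∀ (q : ℕ) (_ : q.Prime) (h : q ∣ k), Function.Injective (D q h) :=
    fun q hq h a b hab => hχ (Units.ext (eq_of_castHom_eq_of_val_div_eq h
      ((hone q hq h a).trans (hone q hq h b).symm) (Fin.mk.inj hab)))
  have hle : ∀ q : ℕ, q.Prime → q ∣ k → Nat.card Γ ≤ k / q := fun q hq h => by
    simpa using Nat.card_le_card_of_injective _ (hD q hq h)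
  have hge : ∀ q : ℕ, q.Prime → q ∣ k → k / q ≤ Nat.card Γ := fun q hq h => by
    have hlt : k / q < k := Nat.div_lt_self (Nat.pos_of_ne_zero hk0) hq.one_lt
    simpa using Nat.card_le_card_of_surjective _ (hs (k / q) (Nat.div_dvd_of_dvd h) hlt.ne)
  obtain ⟨p, hp, hpk⟩ := Nat.exists_prime_and_dvd hk1
  have : Fact p.Prime := ⟨hp⟩
  have hDbij : Function.Bijective (D p hpk) :=
    (hD p hp hpk).bijective_of_nat_card_le (by simpa using hge p hp hpk)
  have hkpow : k = p ^ k.primeFactorsList.length := by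
    refine Nat.eq_prime_pow_of_unique_prime_dvd hk0 fun {q} hq hqk => ?_
    have h : k / q = k / p :=
      le_antisymm ((hge q hq hqk).trans (hle p hp hpk)) ((hge p hp hpk).trans (hle q hq hqk))
    obtain ⟨a, ha⟩ := hqk
    obtain ⟨b, hb⟩ := hpk
    have hqa : k / q = a := by rw [ha, Nat.mul_div_cancel_left _ hq.pos]
    have hpb : k / p = b := by rw [hb, Nat.mul_div_cancel_left _ hp.pos]
    have hab : a = b := by omega
    subst hab
    have ha0 : 0 < a := Nat.pos_of_ne_zero (by rintro rfl; simp at ha; omega)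
    exact Nat.eq_of_mul_eq_mul_right ha0 (ha.symm.trans hb)
  obtain ⟨m, hm⟩ : ∃ m, k = p ^ (m + 2) := by
    rcases h : k.primeFactorsList.length with _ | _ | m
    · rw [h] at hkpow; simp at hkpow; omega
    · rw [h] at hkpow; simp at hkpow; exact absurd hkpow.symm (hne p hp)
    · exact ⟨m, by rw [h] at hkpow; exact hkpow⟩
  have hkdiv : k / p = p ^ (m + 1) := by
    rw [hm, pow_succ, Nat.mul_div_cancel _ hp.pos]
  have hex : ∀ j, j < p ^ (m + 1) → ∃ γ, (χ γ : ZMod k) = 1 + p * j := by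
    intro j hj
    obtain ⟨γ, hγ⟩ := hDbij.2 ⟨j, hkdiv ▸ hj⟩
    refine ⟨γ, ?_⟩
    have h1 : (χ γ : ZMod k).val / p = j := Fin.mk.inj hγ
    have h2 := hone p hp hpk γ
    rw [← ZMod.natCast_zmod_val (χ γ : ZMod k), map_natCast, ← Nat.cast_one,
      ZMod.natCast_eq_natCast_iff', Nat.mod_eq_of_lt hp.one_lt] at h2
    rw [← ZMod.natCast_zmod_val (χ γ : ZMod k), ← Nat.div_add_mod (χ γ : ZMod k).val p, h1, h2]
    push_cast
    ring
  have hpz : (p : ZMod k) ^ (m + 2) = 0 := by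
    rw [← Nat.cast_pow, ← hm, ZMod.natCast_self]
  have hpn : (p : ZMod k) ^ (m + 1) ≠ 0 := by
    rw [← Nat.cast_pow, Ne, ZMod.natCast_eq_zero_iff, hm, Nat.pow_dvd_pow_iff_le_right hp.one_lt]
    omega
  by_contra hk4
  have hdvd : p ∣ p.choose 2 * p ^ m := by
    rcases Nat.eq_zero_or_pos m with rfl | hmpos
    · have hp2 : p ≠ 2 := by rintro rfl; exact hk4 (by simpa using hm)
      exact (hp.dvd_choose_self (by norm_num)
        (lt_of_le_of_ne hp.two_le hp2.symm)).mul_right _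
    · exact (dvd_pow_self p hmpos.ne').mul_left _
  obtain ⟨σ, hσ⟩ := hex 1 (Nat.one_lt_pow (by omega) hp.one_lt)
  obtain ⟨τ, hτ⟩ := hex (p ^ m) (Nat.pow_lt_pow_right hp.one_lt (by omega))
  have hτ' : (χ τ : ZMod k) = 1 + (p : ZMod k) ^ (m + 1) := by
    rw [hτ]; push_cast; ring
  obtain ⟨hχp, hfp⟩ := cocycle_pow hf hτ'
    (by linear_combination (p : ZMod k) ^ m * hpz) p
  have hτp : τ ^ p = 1 := hχ (Units.ext (by
    rw [hχp, map_one, Units.val_one]; linear_combination hpz))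
  rw [hτp, cocycle_one hf] at hfp
  have hστ := cocycle_symm hχ hf σ τ
  rw [hσ, hτ', Nat.cast_one] at hστ
  obtain ⟨w, hw⟩ := hdvd
  have hw' : ((p.choose 2 : ℕ) : ZMod k) * (p : ZMod k) ^ m = p * w := by
    exact_mod_cast congrArg (Nat.cast : ℕ → ZMod k) hw
  have hσ0 : (p : ZMod k) ^ (m + 1) * f σ = 0 := by
    linear_combination -hfp - (1 + (p.choose 2 : ZMod k) * (p : ZMod k) ^ m) * hστ
      - (p : ZMod k) ^ (m + 1) * f σ * hw' - w * f σ * hpz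
  obtain ⟨ρ, hρ⟩ := hs p hpk (hne p hp) 1
  obtain ⟨y, hy⟩ := dvd_of_castHom_eq_zero hpk (z := (χ ρ : ZMod k) - 1)
    (by rw [map_sub, hone p hp hpk, map_one, sub_self])
  obtain ⟨z, hz⟩ := dvd_of_castHom_eq_zero hpk (z := f ρ - 1)
    (by rw [map_sub, map_one, sub_eq_zero]; exact hρ)
  have hσρ := cocycle_symm hχ hf σ ρ
  rw [hσ, hy, Nat.cast_one] at hσρ
  apply hpn
  linear_combination (p : ZMod k) ^ m * hσρ + y * hσ0 - (p : ZMod k) ^ (m + 1) * hz - z * hpz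

end ZMod

section Group

variable {Γ 𝔊 : Type*} [Group Γ] [CommGroup 𝔊] [MulDistribMulAction Γ 𝔊]

lemma smul_mem_of_smul_eq_pow {e : Γ → ℕ} (hact : ∀ (γ : Γ) (g : 𝔊), γ • g = g ^ e γ)
    (a : Subgroup 𝔊) (γ : Γ) (g : 𝔊) (hg : g ∈ a) : γ • g ∈ a :=
  hact γ g ▸ a.pow_mem hg _

/-- A cocycle into a finite group that is surjective modulo every nontrivial subgroup, but not
surjective, vanishes on the elements that act trivially. -/
lemma cocycle_eq_one_of_smul_eq [Finite 𝔊] {e : Γ → ℕ}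
    (hact : ∀ (γ : Γ) (g : 𝔊), γ • g = g ^ e γ) {η : Γ → 𝔊}
    (hcoc : ∀ σ τ : Γ, η (σ * τ) = η σ * σ • η τ) (hns : ¬ Function.Surjective η)
    (hmin : ∀ a : Subgroup 𝔊, a ≠ ⊥ →
      Function.Surjective (fun γ : Γ => (QuotientGroup.mk (η γ) : 𝔊 ⧸ a)))
    {n : Γ} (hn : ∀ g : 𝔊, n • g = g) : η n = 1 := by
  by_contra hne
  have hpow : ∀ i : ℕ, (∀ g : 𝔊, n ^ i • g = g) ∧ η (n ^ i) = η n ^ i := by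
    intro i
    induction i with
    | zero => simpa using hcoc 1 1
    | succ i ih =>
      refine ⟨fun g => ?_, ?_⟩
      · rw [pow_succ, mul_smul, hn, ih.1]
      · rw [pow_succ, hcoc, ih.1, ih.2, pow_succ]
  refine hns fun g => ?_
  obtain ⟨γ, hγ⟩ := hmin (Subgroup.zpowers (η n)) (by rwa [Ne, Subgroup.zpowers_eq_bot]) g
  have hmem := QuotientGroup.eq.1 hγ
  have hmem' := smul_mem_of_smul_eq_pow hact _ γ⁻¹ _ hmem
  obtain ⟨i, hi⟩ := (mem_powers_iff_mem_zpowers.2 hmem')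
  refine ⟨γ * n ^ i, ?_⟩
  rw [hcoc, (hpow i).2]
  change η n ^ i = _ at hi
  rw [hi, smul_inv_smul, mul_inv_cancel_left]

/-- The character of a minimal cocycle is injective. -/
lemma character_injective [Finite 𝔊] {k : ℕ} {χ : Γ →* (ZMod k)ˣ}
    (hact : ∀ (γ : Γ) (g : 𝔊), γ • g = g ^ ((χ γ : ZMod k).val)) {η : Γ → 𝔊}
    (hcoc : ∀ σ τ : Γ, η (σ * τ) = η σ * σ • η τ) (hns : ¬ Function.Surjective η)
    (hmin : ∀ a : Subgroup 𝔊, a ≠ ⊥ →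
      Function.Surjective (fun γ : Γ => (QuotientGroup.mk (η γ) : 𝔊 ⧸ a)))
    (hnorm : ∀ x : Γ, (∀ g : 𝔊, x • g = g) → η x = 1 → x = 1) : Function.Injective χ := by
  rw [injective_iff_map_eq_one]
  intro γ hγ
  have htriv : ∀ g : 𝔊, γ • g = g := fun g => by
    rw [← one_smul Γ g, smul_smul, mul_one, hact γ, hact 1, hγ, map_one]
  exact hnorm γ htriv (cocycle_eq_one_of_smul_eq hact hcoc hns hmin htriv)

end Group

/-- The order of the coefficient group of a minimal cocycle equals its exponent. -/
lemma card_eq_exponent {Γ 𝔊 : Type*} [Group Γ] [CommGroup 𝔊] [Finite Γ] [Finite 𝔊] [Nontrivial 𝔊] {k : ℕ} {χ : Γ →* (ZMod k)ˣ}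
    (hexp : Monoid.exponent 𝔊 = k) (hχ : Function.Injective χ) {η : Γ → 𝔊}
    (hmin : ∀ a : Subgroup 𝔊, a ≠ ⊥ →
      Function.Surjective (fun γ : Γ => (QuotientGroup.mk (η γ) : 𝔊 ⧸ a))) :
    Nat.card 𝔊 = k := by
  have hk0 : k ≠ 0 := hexp ▸ Monoid.exponent_ne_zero_of_finite
  have : NeZero k := ⟨hk0⟩
  have hk1 : k ≠ 1 := fun h => not_subsingleton 𝔊 (Monoid.exp_eq_one_iff.1 (hexp.trans h))
  set p := k.minFac with hpdef
  have hp : p.Prime := Nat.minFac_prime hk1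
  have hpk : p ∣ k := Nat.minFac_dvd k
  have : Fact p.Prime := ⟨hp⟩
  have hkcard : k ∣ Nat.card 𝔊 := hexp ▸ Group.exponent_dvd_nat_card
  obtain ⟨g, hg⟩ := exists_prime_orderOf_dvd_card' p (hpk.trans hkcard)
  have hg1 : g ≠ 1 := fun h => hp.one_lt.ne' (by rw [← hg, h, orderOf_one])
  have hquot := Nat.card_le_card_of_surjective _
    (hmin (Subgroup.zpowers g) (by rwa [Ne, Subgroup.zpowers_eq_bot]))
  have hmul := Subgroup.card_eq_card_quotient_mul_card_subgroup (Subgroup.zpowers g)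
  rw [Nat.card_zpowers, hg] at hmul
  obtain ⟨m, hm⟩ := hkcard
  have hm1 : m = 1 := by
    by_contra hne
    obtain ⟨q, hq, hqm⟩ := Nat.exists_prime_and_dvd hne
    have : Fact q.Prime := ⟨hq⟩
    obtain ⟨h, hh⟩ := exists_prime_orderOf_dvd_card' (G := 𝔊) q (hm ▸ hqm.mul_left k)
    have hqk : q ∣ k := by rw [← hh, ← hexp]; exact Monoid.order_dvd_exponent h
    have hpq : p ≤ q := Nat.minFac_le_of_dvd hq.two_le hqk
    have hcard : 0 < Nat.card 𝔊 := Nat.card_pos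
    have hm0 : 0 < m := Nat.pos_of_ne_zero (by rintro rfl; omega)
    have hqm' : q ≤ m := Nat.le_of_dvd hm0 hqm
    have hΓ := card_le_of_injective hχ hp hpk
    have h1 : k * m ≤ (p - 1) * k := by
      calc k * m = Nat.card (𝔊 ⧸ Subgroup.zpowers g) * p := by rw [← hm, hmul]
        _ ≤ (p - 1) * (k / p) * p := Nat.mul_le_mul_right p (hquot.trans hΓ)
        _ = (p - 1) * k := by rw [mul_assoc, Nat.div_mul_cancel hpk]
    rw [mul_comm] at h1
    have h2 := Nat.le_of_mul_le_mul_right h1 (Nat.pos_of_ne_zero hk0)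
    have := hp.two_le
    omega
  rw [hm, hm1, mul_one]

section Coordinates

variable {Γ : Type*} {k : ℕ}

/-- Surjectivity modulo nontrivial subgroups, read off in coordinates on a cyclic group. -/
lemma castHom_surjective_of_mk_surjective {𝔊 : Type*} [CommGroup 𝔊] [NeZero k]
    (ψ : Additive 𝔊 ≃+ ZMod k) {η : Γ → 𝔊}
    (hmin : ∀ a : Subgroup 𝔊, a ≠ ⊥ →
      Function.Surjective (fun γ : Γ => (QuotientGroup.mk (η γ) : 𝔊 ⧸ a)))
    (d : ℕ) (hd : d ∣ k) (hdk : d ≠ k) :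
    Function.Surjective fun γ => ZMod.castHom hd (ZMod d) (ψ (Additive.ofMul (η γ))) := by
  let F : Additive 𝔊 →+ ZMod d := (ZMod.castHom hd (ZMod d)).toAddMonoidHom.comp ψ.toAddMonoidHom
  let a : Subgroup 𝔊 := AddSubgroup.toSubgroup' F.ker
  have hF : ∀ g : 𝔊, g ∈ a ↔ ZMod.castHom hd (ZMod d) (ψ (Additive.ofMul g)) = 0 :=
    fun g => Iff.rfl
  have ha : a ≠ ⊥ := by
    intro hbot
    have hdlt : d < k := lt_of_le_of_ne (Nat.le_of_dvd (NeZero.pos k) hd) hdk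
    have h0 : (ψ.symm (d : ZMod k)).toMul ∈ a := by
      rw [hF]; simp
    rw [hbot, Subgroup.mem_bot, toMul_eq_one, EmbeddingLike.map_eq_zero_iff,
      ZMod.natCast_eq_zero_iff] at h0
    exact hdk (Nat.dvd_antisymm hd h0)
  intro y
  obtain ⟨x, rfl⟩ := ZMod.castHom_surjective hd y
  obtain ⟨γ, hγ⟩ := hmin a ha (QuotientGroup.mk (ψ.symm x).toMul)
  refine ⟨γ, ?_⟩
  have h := (hF _).1 (QuotientGroup.eq.1 hγ)
  simp only [ofMul_mul, ofMul_inv, ofMul_toMul, map_add, map_neg, AddEquiv.apply_symm_apply] at h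
  exact (neg_add_eq_zero.1 h)

variable [Group Γ]

/-- A generating cocycle on `ℤ/pℤ` for a nontrivial character is, up to a unit,
the standard coboundary `χ - 1`. -/
lemma exists_mul_sub_one [Fact k.Prime] {χ : Γ →* (ZMod k)ˣ} {f : Γ → ZMod k}
    (hχ : Function.Injective χ) (hf : ∀ σ τ, f (σ * τ) = f σ + χ σ * f τ)
    {σ : Γ} (hσ : σ ≠ 1) (hne : ∃ γ, f γ ≠ 0) :
    ∃ c : ZMod k, c ≠ 0 ∧ ∀ γ, c * f γ = χ γ - 1 := by
  have hu : (χ σ : ZMod k) - 1 ≠ 0 := fun h => hσ (hχ (Units.ext (by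
    simpa using sub_eq_zero.1 h)))
  have hs := cocycle_symm hχ hf σ
  have h0 : f σ ≠ 0 := by
    intro h
    obtain ⟨γ, hγ⟩ := hne
    have := hs γ
    rw [h, mul_zero] at this
    exact hγ ((mul_eq_zero.1 this).resolve_left hu)
  refine ⟨(χ σ - 1) / f σ, div_ne_zero hu h0, fun γ => ?_⟩
  rw [div_mul_eq_mul_div, hs, mul_div_cancel_right₀ _ h0]

/-- The image of an embedding of a finite group in `𝔽_pˣ` is a full torsion subgroup. -/
lemma range_eq_torsion [Finite Γ] [Fact k.Prime] {χ : Γ →* (ZMod k)ˣ}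
    (hχ : Function.Injective χ) :
    Set.range χ = {u : (ZMod k)ˣ | u ^ Nat.card Γ = 1} := by
  classical
  refine Set.eq_of_subset_of_ncard_le ?_ ?_ (Set.toFinite _)
  · rintro _ ⟨γ, rfl⟩
    change χ γ ^ Nat.card Γ = 1
    rw [← map_pow, pow_card_eq_one', map_one]
  · rw [← Set.image_univ, Set.ncard_image_of_injective _ hχ, Set.ncard_univ]
    have h := IsCyclic.card_pow_eq_one_le (α := (ZMod k)ˣ) (n := Nat.card Γ) Nat.card_pos
    rw [← Set.ncard_coe_finset] at h
    simpa using h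

/-- The nontrivial element of a group of order two. -/
lemma eq_one_or_eq_of_card_eq_two (hΓ : Nat.card Γ = 2) {σ : Γ} (hσ : σ ≠ 1) (γ : Γ) :
    γ = 1 ∨ γ = σ := by
  obtain ⟨x, y, -, hall⟩ := Nat.card_eq_two_iff.1 hΓ
  have h : ∀ z : Γ, z = x ∨ z = y := fun z => by
    have := hall.symm ▸ Set.mem_univ z
    simpa using this
  rcases h γ with h1 | h1 <;> rcases h 1 with h2 | h2 <;> rcases h σ with h3 | h3 <;>
    simp_all

lemma mul_self_of_card_eq_two (hΓ : Nat.card Γ = 2) (σ : Γ) : σ * σ = 1 := by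
  have : Finite Γ := Nat.finite_of_card_ne_zero (by omega)
  simpa [hΓ, pow_two] using pow_card_eq_one' (G := Γ) (x := σ)

/-- A group of order two is identified with `ℤ/2ℤ`. -/
lemma exists_bijective_zmod_two (hΓ : Nat.card Γ = 2) :
    ∃ φ : Γ → ZMod 2, Function.Bijective φ ∧ (∀ a b, φ (a * b) = φ a + φ b) ∧
      φ 1 = 0 ∧ ∀ σ, σ ≠ 1 → φ σ = 1 := by
  have h2 : ∀ x : ZMod 2, x ≠ 0 → x = 1 := by clear hΓ; decide
  have : Fact (Nat.Prime 2) := ⟨Nat.prime_two⟩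
  have hcyc : IsCyclic Γ := isCyclic_of_prime_card hΓ
  have hcyc' : IsAddCyclic (Additive Γ) := inferInstance
  let e : Additive Γ ≃+ ZMod 2 := (zmodAddCyclicAddEquiv hcyc').symm.trans
    (ZMod.ringEquivCongr hΓ).toAddEquiv
  exact ⟨fun γ => e (Additive.ofMul γ), e.bijective.comp Additive.ofMul.bijective,
    fun a b => map_add e _ _, map_zero e,
    fun σ hσ => h2 _ ((map_ne_zero_iff e e.injective).2 hσ)⟩

/-- Residues modulo `4` with odd reduction are generators. -/
lemma addOrderOf_eq_four {h : 2 ∣ 4} {x : ZMod 4} (hx : ZMod.castHom h (ZMod 2) x = 1) :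
    addOrderOf x = 4 := by
  have hcases : ∀ y : ZMod 4, y = 0 ∨ y = 2 ∨ ¬ 2 ^ 1 • y = 0 := by decide
  have hfour : ∀ y : ZMod 4, 2 ^ (1 + 1) • y = 0 := by decide
  refine addOrderOf_eq_prime_pow (p := 2) (n := 1) ?_ (hfour x)
  rcases hcases x with rfl | rfl | hne
  · rw [map_zero] at hx
    exact absurd hx (by decide)
  · rw [map_ofNat] at hx
    exact absurd hx (by decide)
  · exact hne

end Coordinates

end NonKneser

/-- Let `(Γ, 𝔊, η)` be a minimal non-Kneser triple in which `𝔊` is abelian of exponent `k`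
and the action of `Γ` is given by a character `χ : Γ → (ℤ/kℤ)^×`, i.e. `γ • g = g^{χ(γ)}`.
Then either `k` is an odd prime or `k = 4`, and `𝔊` is cyclic of order `k`.
If `k = p` is an odd prime, then `|Γ| = r` for some `r` with `2 ≤ r ∣ p − 1`, and there are a
group isomorphism `φ` from `Γ` onto the unique subgroup of order `r` of `𝔽_p^×` and a group
isomorphism `ψ : 𝔊 → 𝔽_p^+` with `ψ(γ • g) = φ(γ)·ψ(g)` and `ψ(η(γ)) = φ(γ) − 1`.
If `k = 4`, then `Γ` is cyclic of order `2`, and there are isomorphisms `φ : Γ → ℤ/2ℤ` and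
`ψ : 𝔊 → ℤ/4ℤ` with `ψ(γ • g) = (−1)^{φ(γ)}·ψ(g)`, and `ψ(η(γ))` is a generator of `ℤ/4ℤ`
for the nontrivial `γ ∈ Γ`. -/
theorem minimal_nonKneser_character
    {Γ 𝔊 : Type*} [Group Γ] [Finite Γ] [CommGroup 𝔊] [Finite 𝔊]
    [MulDistribMulAction Γ 𝔊] (k : ℕ) (χ : Γ →* (ZMod k)ˣ)
    (hexp : Monoid.exponent 𝔊 = k)
    (hact : ∀ (γ : Γ) (g : 𝔊), γ • g = g ^ ((χ γ : ZMod k).val))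
    (η : Γ → 𝔊)
    (hcoc : ∀ σ τ : Γ, η (σ * τ) = η σ * σ • η τ)
    (hgen : Subgroup.closure (Set.range η) = ⊤)
    (hns : ¬ Function.Surjective η)
    (hmin : ∀ a : Subgroup 𝔊, a.Normal → (∀ (γ : Γ) (g : 𝔊), g ∈ a → γ • g ∈ a) → a ≠ ⊥ →
        Function.Surjective (fun γ : Γ => (QuotientGroup.mk (η γ) : 𝔊 ⧸ a)))
    (hnorm : ∀ x : Γ, (∀ g : 𝔊, x • g = g) → η x = 1 → x = 1) :
    ((Nat.Prime k ∧ k ≠ 2) ∨ k = 4) ∧ IsCyclic 𝔊 ∧ Nat.card 𝔊 = k ∧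
    -- the odd prime case
    (Nat.Prime k → k ≠ 2 →
      ∃ r : ℕ, 2 ≤ r ∧ r ∣ (k - 1) ∧ Nat.card Γ = r ∧
        ∃ (φ : Γ →* (ZMod k)ˣ) (ψ : 𝔊 → ZMod k),
          Function.Injective φ ∧
          (Set.range φ = {u : (ZMod k)ˣ | u ^ r = 1}) ∧
          Function.Bijective ψ ∧
          (∀ a b : 𝔊, ψ (a * b) = ψ a + ψ b) ∧
          (∀ (γ : Γ) (g : 𝔊), ψ (γ • g) = (φ γ : ZMod k) * ψ g) ∧
          (∀ γ : Γ, ψ (η γ) = (φ γ : ZMod k) - 1)) ∧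
    -- the case k = 4
    (k = 4 → Nat.card Γ = 2 ∧
      ∃ (φ : Γ → ZMod 2) (ψ : 𝔊 → ZMod 4),
        Function.Bijective φ ∧
        (∀ a b : Γ, φ (a * b) = φ a + φ b) ∧
        Function.Bijective ψ ∧
        (∀ a b : 𝔊, ψ (a * b) = ψ a + ψ b) ∧
        (∀ (γ : Γ) (g : 𝔊), ψ (γ • g) = (-1 : ZMod 4) ^ (φ γ).val * ψ g) ∧
        (∀ γ : Γ, γ ≠ 1 → addOrderOf (ψ (η γ)) = 4)) := by
  have hmin' : ∀ a : Subgroup 𝔊, a ≠ ⊥ →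
      Function.Surjective (fun γ : Γ => (QuotientGroup.mk (η γ) : 𝔊 ⧸ a)) := fun a ha =>
    hmin a inferInstance (NonKneser.smul_mem_of_smul_eq_pow hact a) ha
  have hη1 : η 1 = 1 := by simpa using hcoc 1 1
  have : Nontrivial 𝔊 := by
    by_contra h
    rw [not_nontrivial_iff_subsingleton] at h
    exact hns fun g => ⟨1, Subsingleton.elim _ _⟩
  have : NeZero k := ⟨hexp ▸ Monoid.exponent_ne_zero_of_finite⟩
  have hk1 : k ≠ 1 := fun h => not_subsingleton 𝔊 (Monoid.exp_eq_one_iff.1 (hexp.trans h))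
  have hχ := NonKneser.character_injective hact hcoc hns hmin' hnorm
  have hcard : Nat.card 𝔊 = k := NonKneser.card_eq_exponent hexp hχ hmin'
  have hcyc : IsCyclic 𝔊 := IsCyclic.of_exponent_eq_card (hexp.trans hcard.symm)
  have hcyc' : IsAddCyclic (Additive 𝔊) := inferInstance
  obtain ⟨ψ⟩ : Nonempty (Additive 𝔊 ≃+ ZMod k) :=
    ⟨(zmodAddCyclicAddEquiv hcyc').symm.trans (ZMod.ringEquivCongr hcard).toAddEquiv⟩
  have hψact : ∀ (γ : Γ) (g : 𝔊),
      ψ (Additive.ofMul (γ • g)) = (χ γ : ZMod k) * ψ (Additive.ofMul g) := fun γ g => by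
    rw [hact, ofMul_pow, map_nsmul, nsmul_eq_mul, ZMod.natCast_zmod_val]
  let f : Γ → ZMod k := fun γ => ψ (Additive.ofMul (η γ))
  have hf : ∀ σ τ, f (σ * τ) = f σ + χ σ * f τ := fun σ τ => by
    simp only [f, hcoc, ofMul_mul, map_add, hψact]
  have hs := NonKneser.castHom_surjective_of_mk_surjective ψ hmin'
  have hne : ∃ γ, η γ ≠ 1 := by
    by_contra! h
    have hr : Set.range η ⊆ (⊥ : Subgroup 𝔊) := by
      rintro _ ⟨γ, rfl⟩
      exact h γ
    exact bot_ne_top (top_le_iff.1 (hgen ▸ (Subgroup.closure_le _).2 hr))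
  obtain ⟨σ, hσ⟩ := hne
  have hσ1 : σ ≠ 1 := by rintro rfl; exact hσ hη1
  have hΓ2 : 2 ≤ Nat.card Γ := Finite.one_lt_card_iff_nontrivial.2 ⟨σ, 1, hσ1⟩
  have hfσ : f σ ≠ 0 := by simpa [f] using hσ
  refine ⟨?_, hcyc, hcard, ?_, ?_⟩
  · by_cases hkp : k.Prime
    · refine Or.inl ⟨hkp, ?_⟩
      rintro rfl
      have h := NonKneser.card_le_of_injective hχ hkp dvd_rfl
      norm_num at h
      omega
    · exact Or.inr (NonKneser.eq_four_of_not_prime hk1 hkp hχ hf hs)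
  · intro hkp _
    have : Fact k.Prime := ⟨hkp⟩
    obtain ⟨c, hc, hcf⟩ := NonKneser.exists_mul_sub_one hχ hf hσ1 ⟨σ, hfσ⟩
    refine ⟨Nat.card Γ, hΓ2, ?_, rfl, χ, fun g => c * ψ (Additive.ofMul g), hχ,
      NonKneser.range_eq_torsion hχ, ?_, ?_, ?_, hcf⟩
    · have h := Subgroup.card_dvd_of_injective χ hχ
      rwa [Nat.card_eq_fintype_card (α := (ZMod k)ˣ), ZMod.card_units] at h
    · exact (mulLeft_bijective₀ c hc).comp (ψ.bijective.comp Additive.ofMul.bijective)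
    · intro a b
      simp only [ofMul_mul, map_add, mul_add]
    · intro γ g
      simp only [hψact, mul_left_comm]
  · intro hk4
    subst hk4
    have hΓ : Nat.card Γ = 2 := le_antisymm
      (by simpa using NonKneser.card_le_of_injective hχ Nat.prime_two (by norm_num)) hΓ2
    have huniq := NonKneser.eq_one_or_eq_of_card_eq_two hΓ hσ1
    have hσσ := NonKneser.mul_self_of_card_eq_two hΓ σ
    have hχσ : (χ σ : ZMod 4) = -1 := by
      have h1 : (χ σ : ZMod 4) ≠ 1 := fun h => hσ1 (hχ (Units.ext (by simpa using h)))
      have h2 : (χ σ : ZMod 4) * χ σ = 1 := by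
        rw [← Units.val_mul, ← map_mul, hσσ, map_one, Units.val_one]
      generalize (χ σ : ZMod 4) = x at h1 h2
      revert x
      decide
    obtain ⟨φ, hφ, hφmul, hφ1, hφne⟩ := NonKneser.exists_bijective_zmod_two hΓ
    refine ⟨hΓ, φ, fun g => ψ (Additive.ofMul g), hφ, hφmul,
      ψ.bijective.comp Additive.ofMul.bijective, ?_, ?_, ?_⟩
    · intro a b
      simp only [ofMul_mul, map_add]
    · intro γ g
      simp only [hψact]
      rcases huniq γ with h | h
      · rw [h, hφ1, map_one, Units.val_one, ZMod.val_zero, pow_zero]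
      · rw [h, hφne σ hσ1, hχσ, ZMod.val_one, pow_one]
    · intro γ hγ
      rw [(huniq γ).resolve_left hγ]
      change addOrderOf (f σ) = 4
      have hodd : ZMod.castHom (by norm_num : 2 ∣ 4) (ZMod 2) (f σ) = 1 := by
        obtain ⟨ρ, hρ⟩ := hs 2 (by norm_num) (by norm_num) 1
        rcases huniq ρ with h | h
        · simp [h, hη1] at hρ
        · simpa only [h] using hρ
      exact NonKneser.addOrderOf_eq_four hodd
end
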